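/- Let 𝒞 ⊆ 𝕄 be a code, k ∈ {1,…,ℓ}, and r a positive integer with r + m_k ≤ dim(𝒞). If d_{r+m_k}(𝒞) > n_1 + … + n_{k−1}, then d_{r+m_k}(𝒞) ≥ d_r(𝒞) + 1. -/

import Mathlib

open Matrix Finset

section SumRank

variable {F : Type*} [Field F] [Fintype F] {ℓ : ℕ} {m n : Fin ℓ → ℕ}

/-- The sum-rank weight of a tuple of matrices. -/
noncomputable def srk (C : ∀ i : Fin ℓ, Matrix (Fin (m i)) (Fin (n i)) F) : ℕ :=
  ∑ i, (C i).rank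

/-- The minimum sum-rank distance of a code. -/
noncomputable def dmin (𝒞 : Submodule F (∀ i : Fin ℓ, Matrix (Fin (m i)) (Fin (n i)) F)) : ℕ :=
  sInf {w | ∃ C ∈ 𝒞, C ≠ 0 ∧ srk C = w}

/-- The maximum sum-rank weight of a code. -/
noncomputable def maxsrk (𝒞 : Submodule F (∀ i : Fin ℓ, Matrix (Fin (m i)) (Fin (n i)) F)) : ℕ :=
  sSup {w | ∃ C ∈ 𝒞, srk C = w}

/-- An optimal rank-metric anticode in `F^(m×n)`:
an `F`-subspace whose dimension equals `m` times the maximum rank of its elements. -/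
def IsOptRkAnticode {m n : ℕ} (A : Submodule F (Matrix (Fin m) (Fin n) F)) : Prop :=
  Module.finrank F A = m * sSup {r | ∃ M ∈ A, (M : Matrix (Fin m) (Fin n) F).rank = r}

/-- The weight of a sum-rank metric code: the minimum of `maxsrk 𝒜` over all products
`𝒜 = 𝒜₁ × ⋯ × 𝒜_ℓ` of optimal rank-metric anticodes containing `𝒞`. -/
noncomputable def wtCode (𝒞 : Submodule F (∀ i : Fin ℓ, Matrix (Fin (m i)) (Fin (n i)) F)) : ℕ :=
  sInf {w | ∃ A : ∀ i : Fin ℓ, Submodule F (Matrix (Fin (m i)) (Fin (n i)) F),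
    (∀ i, IsOptRkAnticode (A i)) ∧ 𝒞 ≤ Submodule.pi Set.univ A ∧
    w = maxsrk (Submodule.pi Set.univ A)}

/-- The `r`-th generalized sum-rank weight of a code. -/
noncomputable def genWt (𝒞 : Submodule F (∀ i : Fin ℓ, Matrix (Fin (m i)) (Fin (n i)) F))
    (r : ℕ) : ℕ :=
  sInf {w | ∃ 𝒟 : Submodule F (∀ i : Fin ℓ, Matrix (Fin (m i)) (Fin (n i)) F),
    𝒟 ≤ 𝒞 ∧ r ≤ Module.finrank F 𝒟 ∧ w = wtCode 𝒟}

end SumRank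

section Abstract

open Module Submodule

variable {F : Type*} [Field F] {ι : Type*} {E : Type*} [AddCommGroup E] [Module F E]

/-- Leading-row space at `i`. -/
def ldSp (V : Submodule F (ι → E)) (e : ι → ℕ) (i : ι) : Submodule F E where
  carrier := {v | ∃ M ∈ V, (∀ j, e j < e i → M j = 0) ∧ M i = v}
  add_mem' := by
    rintro _ _ ⟨M, hM, h1, rfl⟩ ⟨N, hN, h2, rfl⟩
    exact ⟨M + N, V.add_mem hM hN, fun j hj => by simp [h1 j hj, h2 j hj], rfl⟩
  zero_mem' := ⟨0, V.zero_mem, fun _ _ => rfl, rfl⟩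
  smul_mem' := by
    rintro c _ ⟨M, hM, h1, rfl⟩
    exact ⟨c • M, V.smul_mem c hM, fun j hj => by simp [h1 j hj], rfl⟩

theorem mem_ldSp {V : Submodule F (ι → E)} {e : ι → ℕ} {i : ι} {v : E} :
    v ∈ ldSp V e i ↔ ∃ M ∈ V, (∀ j, e j < e i → M j = 0) ∧ M i = v := Iff.rfl

theorem ldSp_mono {V W : Submodule F (ι → E)} (h : V ≤ W) (e : ι → ℕ) (i : ι) :
    ldSp V e i ≤ ldSp W e i := by
  rintro _ ⟨M, hM, h1, rfl⟩
  exact ⟨M, h hM, h1, rfl⟩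

theorem finrank_le_sum_ldSp_aux [Fintype ι] [FiniteDimensional F E] (e : ι → ℕ) (S : Finset ι) :
    ∀ V : Submodule F (ι → E), (∀ M ∈ V, ∀ i ∉ S, M i = 0) →
      finrank F V ≤ ∑ i ∈ S, finrank F (ldSp V e i) := by
  classical
  induction S using Finset.induction_on_min_value e with
  | empty =>
    intro V hV
    have : V = ⊥ := by
      rw [eq_bot_iff]
      intro M hM
      rw [Submodule.mem_bot]
      ext i
      exact hV M hM i (by simp)
    subst this
    simp
  | insert a s ha hmin ih =>
    intro V hV
    let f : V →ₗ[F] E := (LinearMap.proj a).comp V.subtype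
    have h1 := LinearMap.finrank_range_add_finrank_ker f
    have h2 : finrank F (LinearMap.range f) ≤ finrank F (ldSp V e a) := by
      apply Submodule.finrank_mono
      rintro _ ⟨⟨M, hM⟩, rfl⟩
      refine ⟨M, hM, fun j hj => hV M hM j ?_, rfl⟩
      intro hj'
      rcases Finset.mem_insert.1 hj' with rfl | h
      · exact lt_irrefl _ hj
      · exact absurd (hmin j h) (by omega)
    let V' := (LinearMap.ker f).map V.subtype
    have h3 : finrank F V' = finrank F (LinearMap.ker f) := Submodule.finrank_map_subtype_eq _ _
    have hle : V' ≤ V := Submodule.map_subtype_le _ _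
    have h4 := ih V' (by
      rintro M hM i hi
      by_cases hia : i = a
      · subst hia
        obtain ⟨⟨N, hN⟩, hk, rfl⟩ := hM
        exact hk
      · exact hV M (hle hM) i (by simp [hia, hi]))
    rw [Finset.sum_insert ha]
    have h5 : ∑ i ∈ s, finrank F (ldSp V' e i) ≤ ∑ i ∈ s, finrank F (ldSp V e i) :=
      Finset.sum_le_sum fun i _ => Submodule.finrank_mono (ldSp_mono hle e i)
    omega

theorem finrank_le_sum_ldSp [Fintype ι] [FiniteDimensional F E] (e : ι → ℕ)
    (V : Submodule F (ι → E)) : finrank F V ≤ ∑ i, finrank F (ldSp V e i) :=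
  finrank_le_sum_ldSp_aux e Finset.univ V (by simp)

/-- one-step extension -/
theorem extend_step {a : ι → E} {T : Finset ι} [DecidableEq ι] (hT : LinearIndepOn F a (T : Set ι))
    {j : ι} (hj : j ∉ T) {v : E} (hv : v ∉ span F (a '' (T : Set ι))) :
    LinearIndepOn F (Function.update a j v) ((insert j T : Finset ι) : Set ι) := by
  have heq : Set.EqOn a (Function.update a j v) (T : Set ι) := by
    intro i hi
    rw [Function.update_of_ne]
    rintro rfl
    exact hj hi
  rw [Finset.coe_insert]
  refine (hT.congr heq).insert ?_
  rw [← heq.image_eq]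
  simpa using hv

theorem finrank_span_indep {a : ι → E} {T : Finset ι} (hT : LinearIndepOn F a (T : Set ι)) :
    finrank F (span F (a '' (T : Set ι))) = T.card := by
  have := finrank_span_eq_card (R := F) hT
  rw [Set.image_eq_range]
  simpa using this

theorem exists_not_mem_span {a : ι → E} {T : Finset ι} (hT : LinearIndepOn F a (T : Set ι))
    {P : Submodule F E} (h : T.card < finrank F P) :
    ∃ v ∈ P, v ∉ span F (a '' (T : Set ι)) := by
  by_contra hc
  push Not at hc
  have : FiniteDimensional F (span F (a '' (T : Set ι))) :=
    FiniteDimensional.span_of_finite F (T.finite_toSet.image a)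
  have := Submodule.finrank_mono (R := F) (s := P) (t := span F (a '' (T : Set ι))) hc
  rw [finrank_span_indep hT] at this
  omega

theorem exists_transversal (P : ι → Submodule F E) (N : ℕ) : ∀ S : Finset ι,
    (∀ b < N, N ≤ b + (S.filter fun i => b < finrank F (P i)).card) →
    ∃ T ⊆ S, T.card = N ∧ ∃ a : ι → E, (∀ i ∈ T, a i ∈ P i) ∧ LinearIndepOn F a (T : Set ι) := by
  classical
  induction N with
  | zero => exact fun S _ => ⟨∅, by simp, rfl, 0, by simp, by simp⟩
  | succ N ih =>
    intro S hS
    have h1 := hS N (by omega)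
    obtain ⟨i0, hi0⟩ : (S.filter fun i => N < finrank F (P i)).Nonempty :=
      Finset.card_pos.1 (by omega)
    rw [Finset.mem_filter] at hi0
    obtain ⟨T, hTS, hTc, a, ha, hTa⟩ := ih (S.erase i0) (by
      intro b hb
      have h2 := hS b (by omega)
      rw [Finset.filter_erase, Finset.card_erase_of_mem (by simp [hi0.1]; omega)]
      omega)
    have hiT : i0 ∉ T := fun h => by simpa using hTS h
    obtain ⟨v, hv, hv'⟩ := exists_not_mem_span hTa (P := P i0) (by omega)
    refine ⟨insert i0 T, ?_, by rw [Finset.card_insert_of_notMem hiT, hTc], _, ?_,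
      extend_step hTa hiT hv'⟩
    · exact Finset.insert_subset hi0.1 (hTS.trans (Finset.erase_subset _ _))
    · intro i hi
      by_cases h : i = i0
      · subst h; simpa using hv
      · rw [Function.update_of_ne h]
        exact ha i ((Finset.mem_insert.1 hi).resolve_left h)

theorem exists_extend (P : ι → Submodule F E) [DecidableEq ι] (c : ℕ) (U : Finset ι) :
    ∀ (T : Finset ι) (a : ι → E), LinearIndepOn F a (T : Set ι) → Disjoint T U →
    (T ∪ U).card ≤ c → (∀ i ∈ U, c ≤ finrank F (P i)) →
    ∃ a' : ι → E, (∀ i ∈ T, a' i = a i) ∧ (∀ i ∈ U, a' i ∈ P i) ∧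
      LinearIndepOn F a' ((T ∪ U : Finset ι) : Set ι) := by
  induction U using Finset.induction_on with
  | empty => exact fun T a hT _ _ _ => ⟨a, fun _ _ => rfl, by simp, by simpa using hT⟩
  | insert j U hj ih =>
    intro T a hT hd hc hP
    rw [Finset.disjoint_insert_right] at hd
    rw [Finset.union_insert] at hc ⊢
    have hjn : j ∉ T ∪ U := by simp [hd.1, hj]
    rw [Finset.card_insert_of_notMem hjn] at hc
    obtain ⟨a', h1, h2, h3⟩ := ih T a hT hd.2 (by omega)
      (fun i hi => hP i (Finset.mem_insert_of_mem hi))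
    obtain ⟨v, hv, hv'⟩ := exists_not_mem_span h3 (P := P j)
      (by have := hP j (Finset.mem_insert_self _ _); omega)
    refine ⟨_, ?_, ?_, extend_step h3 hjn hv'⟩
    · intro i hi
      rw [Function.update_of_ne (by rintro rfl; exact hd.1 hi), h1 i hi]
    · intro i hi
      by_cases h : i = j
      · subst h; simpa using hv
      · rw [Function.update_of_ne h]
        exact h2 i ((Finset.mem_insert.1 hi).resolve_left h)

theorem card_le_rank [Finite ι] {M : ι → E} {T : Finset ι} (hT : LinearIndepOn F M (T : Set ι)) :
    T.card ≤ finrank F (span F (Set.range M)) := by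
  have : FiniteDimensional F (span F (Set.range M)) :=
    FiniteDimensional.span_of_finite F (Set.finite_range M)
  rw [← finrank_span_indep hT]
  exact Submodule.finrank_mono (span_mono (Set.image_subset_range _ _))

/-- Leading rows can be realised simultaneously (Meshulam). -/
theorem meshulam [Fintype ι] (V : Submodule F (ι → E)) {e : ι → ℕ} (he : Function.Injective e)
    {T : Finset ι} {a : ι → E} (ha : ∀ i ∈ T, a i ∈ ldSp V e i)
    (hT : LinearIndepOn F a (T : Set ι)) :
    ∃ M ∈ V, LinearIndepOn F M (T : Set ι) := by
  classical
  have key : ∀ k : ℕ, ∃ M ∈ V,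
      LinearIndepOn F (fun i => if e i < k then M i else a i) (T : Set ι) := by
    intro k
    induction k with
    | zero => exact ⟨0, V.zero_mem, by simpa using hT⟩
    | succ k ih =>
      obtain ⟨M, hM, hI⟩ := ih
      by_cases hk : ∃ j ∈ T, e j = k
      · obtain ⟨j, hj, rfl⟩ := hk
        obtain ⟨A, hA, hA0, hAj⟩ := mem_ldSp.1 (ha j hj)
        set g : ι → E := fun i => if e i < e j then M i else a i with hg
        have hTe : (T : Set ι) = insert j ((T.erase j : Finset ι) : Set ι) := by
          rw [← Finset.coe_insert, Finset.insert_erase hj]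
        have hjn : j ∉ ((T.erase j : Finset ι) : Set ι) := by simp
        rw [hTe, linearIndepOn_insert hjn] at hI
        have main : ∀ N ∈ V, (∀ i, e i < e j → N i = M i) →
            N j ∉ span F (g '' ((T.erase j : Finset ι) : Set ι)) →
            ∃ M ∈ V, LinearIndepOn F (fun i => if e i < e j + 1 then M i else a i) (T : Set ι) := by
          intro N hN hNM hNj
          refine ⟨N, hN, ?_⟩
          have heq : Set.EqOn g (fun i => if e i < e j + 1 then N i else a i)
              ((T.erase j : Finset ι) : Set ι) := by
            intro i hi
            have hij : i ≠ j := by rintro rfl; exact hjn hi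
            have : e i ≠ e j := fun h => hij (he h)
            by_cases h : e i < e j
            · simp [hg, h, hNM i h, Nat.lt_succ_of_lt h]
            · have h' : ¬ e i < e j + 1 := by omega
              simp only [hg, h, h', if_false]
          rw [hTe, linearIndepOn_insert hjn]
          refine ⟨hI.1.congr heq, ?_⟩
          rw [← heq.image_eq]
          simpa using hNj
        by_cases hMj : M j ∈ span F (g '' ((T.erase j : Finset ι) : Set ι))
        · refine main (M + A) (V.add_mem hM hA) (fun i hi => by simp [hA0 i hi]) ?_
          intro hc
          apply hI.2
          have := sub_mem hc hMj
          simpa [hAj, hg] using this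
        · exact main M hM (fun _ _ => rfl) hMj
      · refine ⟨M, hM, hI.congr ?_⟩
        intro i hi
        have : e i ≠ k := fun h => hk ⟨i, hi, h⟩
        have : e i < k ↔ e i < k + 1 := by omega
        simp only [this]
  obtain ⟨M, hM, h⟩ := key (∑ i, e i + 1)
  refine ⟨M, hM, h.congr ?_⟩
  intro i _
  have : e i < ∑ i, e i + 1 :=
    Nat.lt_succ_of_le (Finset.single_le_sum (f := e) (fun _ _ => Nat.zero_le _) (Finset.mem_univ i))
  simp only [this, if_true]

theorem exists_cover [Fintype ι] (V : Submodule F (ι → E)) {e : ι → ℕ} (he : Function.Injective e)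
    {c : ℕ} (hV : ∀ M ∈ V, finrank F (span F (Set.range M)) ≤ c) :
    ∃ b, b + (Finset.univ.filter fun i => b < finrank F (ldSp V e i)).card ≤ c := by
  by_contra hc
  push Not at hc
  obtain ⟨T, -, hTc, a, ha, hTa⟩ := exists_transversal (ldSp V e) (c + 1) Finset.univ
    (fun b _ => hc b)
  obtain ⟨M, hM, hI⟩ := meshulam V he ha hTa
  have := card_le_rank hI
  have := hV M hM
  omega

theorem sum_cover_le [Fintype ι] [FiniteDimensional F E] (P : ι → Submodule F E) (b : ℕ) :
    ∑ i, finrank F (P i) + b * (Finset.univ.filter fun i => b < finrank F (P i)).card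
     ≤ finrank F E * (Finset.univ.filter fun i => b < finrank F (P i)).card
      + b * Fintype.card ι := by
  have h1 : ∀ i, finrank F (P i) + (if b < finrank F (P i) then b else 0)
      ≤ (if b < finrank F (P i) then finrank F E else 0) + b := by
    intro i
    have := Submodule.finrank_le (P i)
    split_ifs <;> omega
  have h2 := Finset.sum_le_sum (s := Finset.univ) fun i _ => h1 i
  simp only [Finset.sum_add_distrib, ← Finset.sum_filter, Finset.sum_const, smul_eq_mul,
    Finset.card_univ] at h2
  nlinarith

theorem exists_inj_nat (ι : Type*) [Fintype ι] : ∃ e : ι → ℕ, Function.Injective e :=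
  ⟨fun i => (Fintype.equivFin ι i : ℕ), fun i j h => by
    have := Fin.ext h
    simpa using this⟩

theorem finrank_bound [Fintype ι] [FiniteDimensional F E] (V : Submodule F (ι → E))
    (hn : finrank F E ≤ Fintype.card ι) {c : ℕ}
    (hV : ∀ M ∈ V, finrank F (span F (Set.range M)) ≤ c) : finrank F V ≤ Fintype.card ι * c := by
  obtain ⟨e, he⟩ := exists_inj_nat ι
  obtain ⟨b, hb⟩ := exists_cover V he hV
  have h1 := finrank_le_sum_ldSp e V
  have h2 := sum_cover_le (ldSp V e) b
  set a := (Finset.univ.filter fun i => b < finrank F (ldSp V e i)).card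
  nlinarith [Nat.mul_le_mul_left (Fintype.card ι) hb, Nat.mul_le_mul_right a hn]

theorem dichotomy [Fintype ι] [FiniteDimensional F E] (V : Submodule F (ι → E))
    (hn : finrank F E ≤ Fintype.card ι) {c : ℕ} (hc : 0 < c) (hm : 0 < Fintype.card ι)
    (hV : ∀ M ∈ V, finrank F (span F (Set.range M)) ≤ c)
    (hd : finrank F V = Fintype.card ι * c) {e : ι → ℕ} (he : Function.Injective e) :
    (∀ i, finrank F (ldSp V e i) = c) ∨ (finrank F E = Fintype.card ι ∧ ∃ I : Finset ι,
      I.card = c ∧ ∀ i ∉ I, ldSp V e i = ⊥) := by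
  obtain ⟨b, hb⟩ := exists_cover V he hV
  have h1 := finrank_le_sum_ldSp e V
  have h2 := sum_cover_le (ldSp V e) b
  set A := (Finset.univ.filter fun i => b < finrank F (ldSp V e i)) with hA
  have h3 := Nat.mul_le_mul_left (Fintype.card ι) hb
  have h4 := Nat.mul_le_mul_right A.card hn
  have h5 : b * A.card = 0 := by nlinarith
  rcases Nat.mul_eq_zero.1 h5 with hb0 | ha0
  · right
    subst hb0
    have h6 : c ≤ A.card := by
      have : Fintype.card ι * c ≤ Fintype.card ι * A.card := by nlinarith
      exact Nat.le_of_mul_le_mul_left this hm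
    have h7 : A.card = c := by omega
    refine ⟨?_, A, h7, ?_⟩
    · have : Fintype.card ι * c ≤ finrank F E * c := by rw [h7] at h2; nlinarith
      exact le_antisymm hn (Nat.le_of_mul_le_mul_right this hc)
    · intro i hi
      have : finrank F (ldSp V e i) = 0 := by simpa [hA] using hi
      exact Submodule.finrank_eq_zero.1 this
  · left
    have h6 : c ≤ b := by
      have : Fintype.card ι * c ≤ Fintype.card ι * b := by rw [ha0] at h2; nlinarith
      exact Nat.le_of_mul_le_mul_left this hm
    have h7 : b = c := by omega
    subst h7
    have h8 : ∀ i ∈ Finset.univ, finrank F (ldSp V e i) ≤ b := by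
      intro i _
      by_contra h
      have : i ∈ A := by simp [hA]; omega
      rw [Finset.card_eq_zero.1 ha0] at this
      simp at this
    have h9 : ∑ i, finrank F (ldSp V e i) = ∑ i : ι, b := by
      apply le_antisymm (Finset.sum_le_sum h8)
      simpa [← hd] using h1
    have := (Finset.sum_eq_sum_iff_of_le h8).1 h9
    exact fun i => this i (Finset.mem_univ i)

theorem range_compat {κ : Type*} [Fintype κ] [DecidableEq κ] [FiniteDimensional F E]
    (hκ : Fintype.card κ < finrank F E)
    (T : (κ → E) →ₗ[F] E)
    (hT : ∀ ψ : κ → E, LinearIndependent F ψ → T ψ ∈ span F (Set.range ψ)) (s : κ) (v : E) :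
    T (Pi.single s v) ∈ span F {v} := by
  by_cases hv : v = 0
  · subst hv; simp
  by_contra hw
  set w := T (Pi.single s v) with hwdef
  obtain ⟨t, ht⟩ : ∃ t : κ, t ≠ s ∨ ∀ x : κ, x = s := by
    by_cases h : ∃ t : κ, t ≠ s
    · exact ⟨h.choose, Or.inl h.choose_spec⟩
    · push Not at h
      exact ⟨s, Or.inr h⟩
  let a : Option κ → E := fun o => o.elim w (fun _ => v)
  have ha : LinearIndepOn F a (({none, some t} : Finset (Option κ)) : Set (Option κ)) := by
    have h1 : LinearIndepOn F a ({some t} : Set (Option κ)) := by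
      rw [linearIndepOn_singleton_iff]
      exact hv
    have h2 := h1.insert (x := none) (by simpa [a] using hw)
    simpa using h2
  obtain ⟨a', h1, -, h3⟩ := exists_extend (F := F) (fun _ : Option κ => (⊤ : Submodule F E))
    (finrank F E) ({none, some t} : Finset (Option κ))ᶜ {none, some t} a ha disjoint_compl_right
    (by rw [Finset.union_compl, Finset.card_univ, Fintype.card_option]; omega) (by simp)
  rw [Finset.union_compl, Finset.coe_univ, linearIndepOn_univ_iff, linearIndependent_option] at h3
  have hn : a' none = w := h1 none (by simp)
  have hst : a' (some t) = v := h1 (some t) (by simp)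
  obtain ⟨hψ, hwn⟩ := h3
  rw [hn] at hwn
  set ψ : κ → E := a' ∘ some with hψdef
  have hψt : ψ t = v := hst
  rcases ht with ht | ht
  · have hψ' : LinearIndependent F (Function.update ψ s (ψ s + v)) := by
      have h := hψ
      rw [← linearIndepOn_univ_iff, ← Finset.coe_univ, ← Finset.insert_erase (Finset.mem_univ s),
        Finset.coe_insert, linearIndepOn_insert (by simp)] at h
      have h2 := extend_step (T := Finset.univ.erase s) (j := s) (v := ψ s + v) h.1 (by simp) (by
        intro hc
        apply h.2
        have : v ∈ span F (ψ '' ((Finset.univ.erase s : Finset κ) : Set κ)) :=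
          subset_span ⟨t, by simp [ht], hψt⟩
        simpa using sub_mem hc this)
      rw [Finset.insert_erase (Finset.mem_univ s), Finset.coe_univ, linearIndepOn_univ_iff] at h2
      exact h2
    have h4 := hT _ hψ
    have h5 := hT _ hψ'
    have h6 : span F (Set.range (Function.update ψ s (ψ s + v))) ≤ span F (Set.range ψ) := by
      rw [span_le]
      rintro _ ⟨i, rfl⟩
      by_cases hi : i = s
      · subst hi
        simp only [Function.update_self, SetLike.mem_coe]
        refine add_mem (subset_span ⟨i, rfl⟩) (subset_span ⟨t, hψt⟩)
      · rw [Function.update_of_ne hi]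
        exact subset_span ⟨i, rfl⟩
    have h7 : Function.update ψ s (ψ s + v) = ψ + Pi.single s v := by
      ext i
      by_cases hi : i = s
      · subst hi; simp
      · simp [hi]
    apply hwn
    have := sub_mem (h6 h5) h4
    rw [h7, map_add] at this
    simpa using this
  · have hts := ht t
    subst hts
    have : ψ = Pi.single t v := by
      ext i
      rw [ht i, hψt, Pi.single_eq_same]
    apply hwn
    have h4 := hT _ hψ
    rw [this] at h4 ⊢
    exact h4

theorem caseB [Fintype ι] [FiniteDimensional F E] (V : Submodule F (ι → E))
    {c : ℕ} (hc : 0 < c) (hcE : c < finrank F E)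
    (hV : ∀ M ∈ V, finrank F (span F (Set.range M)) ≤ c)
    (hd : finrank F V = finrank F E * c) (I : Finset ι) (hI : I.card = c)
    (hinj : ∀ M ∈ V, (∀ i ∈ I, M i = 0) → M = 0) :
    ∃ B ≤ V, finrank F V ≤ finrank F B + finrank F E ∧
      ∀ M ∈ B, finrank F (span F (Set.range M)) ≤ c - 1 := by
  classical
  let R : V →ₗ[F] (I → E) := LinearMap.pi fun i => (LinearMap.proj (i : ι)).comp V.subtype
  have hR : Function.Injective R := by
    rw [← LinearMap.ker_eq_bot, LinearMap.ker_eq_bot']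
    rintro ⟨M, hM⟩ h
    have := hinj M hM (fun i hi => congrFun h ⟨i, hi⟩)
    simpa using this
  have hfr : finrank F V = finrank F (I → E) := by
    rw [Module.finrank_pi_fintype, hd]
    simp [hI, mul_comm]
  let R' : V ≃ₗ[F] (I → E) := LinearEquiv.ofInjectiveOfFinrankEq R hR hfr
  have hR' : ∀ (M : V) (i : I), R' M i = (M : ι → E) i := fun M i => rfl
  have hrows : ∀ M ∈ V, ∀ j, M j ∈ span F (M '' (I : Set ι)) ∨
      ¬ LinearIndepOn F M (I : Set ι) := by
    intro M hM j
    by_contra hcon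
    push Not at hcon
    obtain ⟨h1, h2⟩ := hcon
    have hj : j ∉ I := fun h => h1 (subset_span ⟨j, h, rfl⟩)
    have h3 : LinearIndepOn F M ((insert j I : Finset ι) : Set ι) := by
      rw [Finset.coe_insert]; exact h2.insert h1
    have := card_le_rank h3
    rw [Finset.card_insert_of_notMem hj] at this
    have := hV M hM
    omega
  have key : ∀ (j : ι) (s : I) (v : E),
      (R'.symm (Pi.single s v) : ι → E) j ∈ span F {v} := by
    intro j s v
    refine range_compat (by simpa [hI] using hcE)
      (((LinearMap.proj j).comp V.subtype).comp R'.symm.toLinearMap) ?_ s v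
    intro ψ hψ
    have h1 : ∀ i : I, (R'.symm ψ : ι → E) i = ψ i := by
      intro i; rw [← hR', LinearEquiv.apply_symm_apply]
    have h2 := hrows (R'.symm ψ : ι → E) (R'.symm ψ).2 j
    have h3 : (fun i : I => (R'.symm ψ : ι → E) i) = ψ := funext h1
    have h4 : LinearIndepOn F (R'.symm ψ : ι → E) (I : Set ι) := by
      change LinearIndependent F (fun i : I => (R'.symm ψ : ι → E) i)
      rw [h3]; exact hψ
    have h5 := h2.resolve_right (not_not.2 h4)
    rw [Set.image_eq_range] at h5
    change _ ∈ span F (Set.range (fun i : I => (R'.symm ψ : ι → E) i)) at h5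
    rw [h3] at h5
    exact h5
  obtain ⟨i0, hi0⟩ : I.Nonempty := Finset.card_pos.1 (by omega)
  let f : V →ₗ[F] E := (LinearMap.proj i0).comp V.subtype
  refine ⟨(LinearMap.ker f).map V.subtype, Submodule.map_subtype_le _ _, ?_, ?_⟩
  · rw [Submodule.finrank_map_subtype_eq]
    have h1 := LinearMap.finrank_range_add_finrank_ker f
    have h2 := Submodule.finrank_le (LinearMap.range f)
    omega
  · rintro _ ⟨M, hMk, rfl⟩
    have h0 : (M : ι → E) i0 = 0 := hMk
    have hle : span F (Set.range (M : ι → E)) ≤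
        span F (((I.erase i0).image (M : ι → E) : Finset E) : Set E) := by
      rw [span_le]
      rintro _ ⟨j, rfl⟩
      have h1 : M = ∑ s : I, R'.symm (Pi.single s ((M : ι → E) s)) := by
        rw [← map_sum, LinearEquiv.eq_symm_apply]
        ext s
        rw [hR', Finset.sum_apply, Finset.sum_pi_single]
        simp
      have h2 : (M : ι → E) j = ∑ s : I, (R'.symm (Pi.single s ((M : ι → E) s)) : ι → E) j := by
        conv_lhs => rw [h1]
        simp
      rw [h2]
      refine sum_mem fun s _ => ?_
      have h3 := key j s ((M : ι → E) s)
      by_cases hs : (s : ι) = i0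
      · rw [hs, h0] at h3
        rw [hs, h0]
        rw [Submodule.span_zero_singleton, Submodule.mem_bot] at h3
        rw [h3]
        exact zero_mem _
      · refine span_mono ?_ h3
        rintro _ rfl
        rw [Finset.mem_coe]
        exact Finset.mem_image_of_mem _ (Finset.mem_erase.2 ⟨hs, s.2⟩)
    refine (Submodule.finrank_mono hle).trans ?_
    refine (finrank_span_finset_le_card (R := F) _).trans ?_
    refine Finset.card_image_le.trans ?_
    rw [Finset.card_erase_of_mem hi0, hI]

/-- rows in a common subspace -/
theorem caseA [Fintype ι] [FiniteDimensional F E] (V : Submodule F (ι → E))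
    {c : ℕ} (hc : 0 < c) (P : Submodule F E) (hP : finrank F P = c)
    (hrow : ∀ M ∈ V, ∀ i, M i ∈ P) :
    ∃ B ≤ V, finrank F V ≤ finrank F B + Fintype.card ι ∧
      ∀ M ∈ B, finrank F (span F (Set.range M)) ≤ c - 1 := by
  have hne : P ≠ ⊥ := by
    rintro rfl
    simp at hP; omega
  obtain ⟨v, hvP, hv0⟩ := Submodule.exists_mem_ne_zero_of_ne_bot hne
  obtain ⟨g, hg⟩ : ∃ g : Module.Dual F E, g v ≠ 0 := by
    by_contra h
    push Not at h
    exact hv0 ((Module.forall_dual_apply_eq_zero_iff F v).1 h)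
  let f : V →ₗ[F] (ι → F) := LinearMap.pi fun i => (g.comp (LinearMap.proj i)).comp V.subtype
  refine ⟨(LinearMap.ker f).map V.subtype, Submodule.map_subtype_le _ _, ?_, ?_⟩
  · rw [Submodule.finrank_map_subtype_eq]
    have h1 := LinearMap.finrank_range_add_finrank_ker f
    have h2 := Submodule.finrank_le (LinearMap.range f)
    rw [Module.finrank_fintype_fun_eq_card] at h2
    omega
  · rintro _ ⟨M, hMk, rfl⟩
    have hle : span F (Set.range (M : ι → E)) ≤ P ⊓ LinearMap.ker g := by
      rw [span_le]
      rintro _ ⟨j, rfl⟩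
      exact ⟨hrow M M.2 j, congrFun hMk j⟩
    have hlt : P ⊓ LinearMap.ker g < P := by
      refine lt_of_le_of_ne inf_le_left fun h => hg ?_
      rw [← h] at hvP
      exact hvP.2
    have h1 := Submodule.finrank_mono hle
    have h2 := Submodule.finrank_lt_finrank_of_lt hlt
    change finrank F (span F (Set.range (M : ι → E))) ≤ _
    omega

theorem all_eq [Fintype ι] [FiniteDimensional F E] (V : Submodule F (ι → E))
    {c : ℕ} (hc : 0 < c) (hcι : c < Fintype.card ι)
    (hV : ∀ M ∈ V, finrank F (span F (Set.range M)) ≤ c)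
    (P : ι → Submodule F E) (hP : ∀ i, finrank F (P i) = c)
    (hPV : ∀ M : ι → E, (∀ i, M i ∈ P i) → M ∈ V) (i j : ι) : P i = P j := by
  classical
  by_contra hne
  have hij : i ≠ j := by rintro rfl; exact hne rfl
  have hnle : ¬ P i ≤ P j := fun h =>
    hne (Submodule.eq_of_le_of_finrank_eq h ((hP i).trans (hP j).symm))
  obtain ⟨x, hxi, hxj⟩ := SetLike.not_le_iff_exists.1 hnle
  have hx0 : x ≠ 0 := by rintro rfl; exact hxj (zero_mem _)
  obtain ⟨U, hUs, hUc⟩ := Finset.exists_subset_card_eq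
    (s := (Finset.univ.erase j).erase i) (n := c - 1) (by
      rw [Finset.card_erase_of_mem (by simp [hij]), Finset.card_erase_of_mem (by simp),
        Finset.card_univ]; omega)
  have hiU : i ∉ U := fun h => by simpa using hUs h
  have hjU : j ∉ U := fun h => by simpa using hUs h
  obtain ⟨a, h1, h2, h3⟩ := exists_extend P c U {i} (fun _ => x)
    (by rw [Finset.coe_singleton, linearIndepOn_singleton_iff]; exact hx0)
    (by simpa using hiU)
    (by rw [← Finset.insert_eq, Finset.card_insert_of_notMem hiU]; omega)
    (fun k _ => (hP k).ge)
  have hcard : ({i} ∪ U : Finset ι).card = c := by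
    rw [← Finset.insert_eq, Finset.card_insert_of_notMem hiU]; omega
  have hai : a i = x := h1 i (by simp)
  have hjn : j ∉ {i} ∪ U := by simp [hjU, hij.symm]
  have hsp : finrank F (span F (a '' (({i} ∪ U : Finset ι) : Set ι))) = c := by
    rw [finrank_span_indep h3, hcard]
  obtain ⟨v, hvP, hv⟩ : ∃ v ∈ P j, v ∉ span F (a '' (({i} ∪ U : Finset ι) : Set ι)) := by
    by_contra hcon
    push Not at hcon
    have heq := Submodule.eq_of_le_of_finrank_eq (S₁ := P j) hcon ((hP j).trans hsp.symm)
    apply hxj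
    rw [heq, ← hai]
    exact subset_span ⟨i, by simp, rfl⟩
  have h4 := extend_step h3 hjn hv
  set S := insert j ({i} ∪ U) with hS
  set b := Function.update a j v with hb
  let M : ι → E := fun k => if k ∈ S then b k else 0
  have hM : M ∈ V := by
    apply hPV
    intro k
    by_cases hk : k ∈ S
    · simp only [M, hk, if_true]
      by_cases hkj : k = j
      · subst hkj; simpa [hb] using hvP
      · rw [hb, Function.update_of_ne hkj]
        have hk' := (Finset.mem_insert.1 hk).resolve_left hkj
        rcases Finset.mem_union.1 hk' with h | h
        · rw [Finset.mem_singleton] at h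
          subst h; rw [hai]; exact hxi
        · exact h2 k h
    · simp only [M, hk, if_false]; exact zero_mem _
  have h5 : LinearIndepOn F M (S : Set ι) := h4.congr (by
    intro k hk
    have hk' : k ∈ S := hk
    simp only [M, hk', if_true])
  have h6 := card_le_rank h5
  rw [hS, Finset.card_insert_of_notMem hjn, hcard] at h6
  have := hV M hM
  omega

theorem key_drop [Fintype ι] [FiniteDimensional F E] (V : Submodule F (ι → E))
    (hn : finrank F E ≤ Fintype.card ι) {c : ℕ} (hc : 0 < c) (hcE : c ≤ finrank F E)
    (hV : ∀ M ∈ V, finrank F (span F (Set.range M)) ≤ c)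
    (hd : finrank F V = Fintype.card ι * c) :
    ∃ B ≤ V, finrank F V ≤ finrank F B + Fintype.card ι ∧
      ∀ M ∈ B, finrank F (span F (Set.range M)) ≤ c - 1 := by
  classical
  rcases hcE.eq_or_lt with hcE | hcE
  · exact caseA V hc ⊤ (by rw [finrank_top, hcE]) (fun _ _ _ => trivial)
  have hm : 0 < Fintype.card ι := by omega
  obtain ⟨e, he⟩ := exists_inj_nat ι
  let e' : ι → ι → ℕ := fun i0 j => if j = i0 then ∑ i, e i + 1 else e j
  have hlt : ∀ i, e i < ∑ i, e i + 1 := fun i =>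
    Nat.lt_succ_of_le (Finset.single_le_sum (f := e) (fun _ _ => Nat.zero_le _) (Finset.mem_univ i))
  have he' : ∀ i0, Function.Injective (e' i0) := by
    intro i0 j k hjk
    have h1 := hlt j
    have h2 := hlt k
    simp only [e'] at hjk
    split_ifs at hjk with h3 h4 h4
    · rw [h3, h4]
    · omega
    · omega
    · exact he hjk
  by_cases hB : ∃ i0, finrank F E = Fintype.card ι ∧ ∃ I : Finset ι,
      I.card = c ∧ ∀ i ∉ I, ldSp V (e' i0) i = ⊥
  · obtain ⟨i0, hEm, I, hI, hIb⟩ := hB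
    rw [← hEm]
    refine caseB V hc hcE hV (by rw [hd, hEm]) I hI ?_
    intro M hM hM0
    by_contra hne
    have : (Finset.univ.filter fun i => M i ≠ 0).Nonempty := by
      by_contra h
      rw [Finset.not_nonempty_iff_eq_empty, Finset.filter_eq_empty_iff] at h
      apply hne
      ext i
      simpa using h (Finset.mem_univ i)
    obtain ⟨i, hi, hmin⟩ := Finset.exists_min_image _ (e' i0) this
    have hi0 : M i ≠ 0 := by simpa using hi
    have hiI : i ∉ I := fun h => hi0 (hM0 i h)
    have h1 : M i ∈ ldSp V (e' i0) i := by
      refine ⟨M, hM, fun j hj => ?_, rfl⟩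
      by_contra hj0
      have := hmin j (by simpa using hj0)
      omega
    rw [hIb i hiI] at h1
    exact hi0 (by simpa using h1)
  · have hA : ∀ i0 i, finrank F (ldSp V (e' i0) i) = c := fun i0 =>
      (dichotomy V hn hc hm hV hd (he' i0)).resolve_right fun h => hB ⟨i0, h⟩
    let P : ι → Submodule F E := fun i => ldSp V (e' i) i
    have hPc : ∀ i, finrank F (P i) = c := fun i => hA i i
    have hsingle : ∀ i, ∀ v ∈ P i, Pi.single i v ∈ V := by
      rintro i _ ⟨M, hM, h0, rfl⟩
      convert hM using 1
      ext j
      by_cases hj : j = i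
      · subst hj; simp
      · rw [Pi.single_eq_of_ne hj, h0 j]
        simpa [e', hj] using hlt j
    have hPV : ∀ M : ι → E, (∀ i, M i ∈ P i) → M ∈ V := by
      intro M hM
      rw [← Finset.univ_sum_single M]
      exact sum_mem fun i _ => hsingle i _ (hM i)
    have heq := all_eq V hc (by omega) hV P hPc hPV
    obtain ⟨i1⟩ : Nonempty ι := Fintype.card_pos_iff.1 hm
    let f : (∀ i, P i) →ₗ[F] V := LinearMap.codRestrict V
      (LinearMap.pi fun i => (P i).subtype.comp (LinearMap.proj i))
      (fun x => hPV _ fun i => (x i).2)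
    have hf : Function.Injective f := by
      intro x y hxy
      ext i
      exact congrFun (congrArg Subtype.val hxy) i
    have hfr : finrank F (∀ i, P i) = finrank F V := by
      rw [Module.finrank_pi_fintype, hd]
      simp [hPc]
    have hsurj := (LinearMap.injective_iff_surjective_of_finrank_eq_finrank hfr).1 hf
    refine caseA V hc (P i1) (hPc i1) ?_
    intro M hM i
    obtain ⟨x, hx⟩ := hsurj ⟨M, hM⟩
    have : M i = x i := by
      have := congrFun (congrArg Subtype.val hx) i
      exact this.symm
    rw [this, heq i1 i]
    exact (x i).2

end Abstract

section Wiring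

open Module Submodule

variable {F : Type*} [Field F]

/-- maximal rank -/
noncomputable def maxRk {m n : ℕ} (A : Submodule F (Matrix (Fin m) (Fin n) F)) : ℕ :=
  sSup {r | ∃ M ∈ A, (M : Matrix (Fin m) (Fin n) F).rank = r}

theorem rank_bdd {m n : ℕ} (A : Submodule F (Matrix (Fin m) (Fin n) F)) :
    BddAbove {r | ∃ M ∈ A, (M : Matrix (Fin m) (Fin n) F).rank = r} := by
  refine ⟨n, ?_⟩
  rintro _ ⟨M, -, rfl⟩
  exact (Matrix.rank_le_card_width M).trans (by simp)

theorem rank_le_maxRk {m n : ℕ} {A : Submodule F (Matrix (Fin m) (Fin n) F)}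
    {M : Matrix (Fin m) (Fin n) F} (hM : M ∈ A) : M.rank ≤ maxRk A :=
  le_csSup (rank_bdd A) ⟨M, hM, rfl⟩

theorem exists_maxRk {m n : ℕ} (A : Submodule F (Matrix (Fin m) (Fin n) F)) :
    ∃ M ∈ A, M.rank = maxRk A :=
  Nat.sSup_mem (s := {r | ∃ M ∈ A, (M : Matrix (Fin m) (Fin n) F).rank = r})
    ⟨_, 0, A.zero_mem, rfl⟩ (rank_bdd A)

theorem maxRk_le {m n : ℕ} (A : Submodule F (Matrix (Fin m) (Fin n) F)) : maxRk A ≤ n := by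
  obtain ⟨M, -, h⟩ := exists_maxRk A
  rw [← h]
  exact (Matrix.rank_le_card_width M).trans (by simp)

theorem anticode_drop {m n : ℕ} (hnm : n ≤ m) (A : Submodule F (Matrix (Fin m) (Fin n) F))
    (hA : finrank F A = m * maxRk A) (hpos : 0 < maxRk A) :
    ∃ B ≤ A, finrank F B = m * maxRk B ∧ maxRk B + 1 ≤ maxRk A ∧
      finrank F A ≤ finrank F B + m := by
  have hrk : ∀ M : Matrix (Fin m) (Fin n) F,
      M.rank = finrank F (span F (Set.range (M : Fin m → Fin n → F))) := fun M =>
    Matrix.rank_eq_finrank_span_row M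
  have hE : finrank F (Fin n → F) = n := by simp
  have hι : Fintype.card (Fin m) = m := by simp
  obtain ⟨B, hBA, h1, h2⟩ := key_drop (F := F) (ι := Fin m) (E := Fin n → F) A
    (by rw [hE, hι]; exact hnm) hpos (by rw [hE]; exact maxRk_le A)
    (fun M hM => (hrk M).symm.trans_le (rank_le_maxRk (A := A) (M := M) hM))
    (by rw [hι]; exact hA)
  rw [hι] at h1
  let B' : Submodule F (Matrix (Fin m) (Fin n) F) := B
  have h3 : maxRk B' + 1 ≤ maxRk A := by
    obtain ⟨M, hM, h⟩ := exists_maxRk B'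
    have := h2 M hM
    rw [← hrk, h] at this
    omega
  have h4 : finrank F B' ≤ m * maxRk B' := by
    have := finrank_bound (F := F) (ι := Fin m) (E := Fin n → F) B
      (by rw [hE, hι]; exact hnm) (c := maxRk B')
      (fun M hM => (hrk M).symm.trans_le (rank_le_maxRk (A := B') (M := M) hM))
    rw [hι] at this
    exact this
  have h5 : finrank F A ≤ finrank F B' + m := h1
  refine ⟨B', hBA, ?_, h3, h5⟩
  have h6 : m * (maxRk B' + 1) ≤ m * maxRk A := Nat.mul_le_mul_left _ h3
  rw [hA] at h5
  apply le_antisymm h4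
  rw [mul_add] at h6
  omega

variable {ℓ : ℕ} {m n : Fin ℓ → ℕ}

theorem maxsrk_pi [Fintype F] (A : ∀ i : Fin ℓ, Submodule F (Matrix (Fin (m i)) (Fin (n i)) F)) :
    maxsrk (Submodule.pi Set.univ A) = ∑ i, maxRk (A i) := by
  have hle : ∀ w ∈ {w | ∃ C ∈ Submodule.pi Set.univ A, srk C = w}, w ≤ ∑ i, maxRk (A i) := by
    rintro _ ⟨C, hC, rfl⟩
    exact Finset.sum_le_sum fun i _ => rank_le_maxRk (hC i (Set.mem_univ i))
  choose M hM hMr using fun i => exists_maxRk (A i)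
  have hmem : ∑ i, maxRk (A i) ∈ {w | ∃ C ∈ Submodule.pi Set.univ A, srk C = w} :=
    ⟨M, fun i _ => hM i, Finset.sum_congr rfl fun i _ => hMr i⟩
  exact le_antisymm (csSup_le ⟨_, hmem⟩ hle) (le_csSup ⟨_, hle⟩ hmem)

theorem top_opt {m n : ℕ} (hnm : n ≤ m) :
    finrank F (⊤ : Submodule F (Matrix (Fin m) (Fin n) F)) =
      m * maxRk (⊤ : Submodule F (Matrix (Fin m) (Fin n) F)) := by
  set A := (⊤ : Submodule F (Matrix (Fin m) (Fin n) F)) with hAdef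
  have h0 : finrank F A = m * n := by
    rw [hAdef, finrank_top, Module.finrank_matrix]; simp
  apply le_antisymm
  · have hE : finrank F (Fin n → F) = n := by simp
    have hι : Fintype.card (Fin m) = m := by simp
    have := finrank_bound (F := F) (ι := Fin m) (E := Fin n → F) A
      (by rw [hE, hι]; exact hnm) (c := maxRk A)
      (fun M hM => (Matrix.rank_eq_finrank_span_row (m := Fin m) (n := Fin n) (R := F) M).symm.trans_le
        (rank_le_maxRk (A := A) (M := M) hM))
    rw [hι] at this
    exact this
  · rw [h0]
    exact Nat.mul_le_mul_left _ (maxRk_le A)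

end Wiring

/-- Growth of generalized weights: if `d_{r+m_k}(𝒞) > n₁ + ⋯ + n_{k-1}`, then
`d_{r+m_k}(𝒞) ≥ d_r(𝒞) + 1`. -/
theorem genWt_growth {F : Type*} [Field F] [Fintype F] {ℓ : ℕ}
    (m n : Fin ℓ → ℕ) (hℓ : 0 < ℓ) (hm : ∀ i j : Fin ℓ, i ≤ j → m j ≤ m i)
    (hmpos : ∀ i, 0 < m i) (hnm : ∀ i, n i ≤ m i) (hnpos : ∀ i, 0 < n i)
    (𝒞 : Submodule F (∀ i : Fin ℓ, Matrix (Fin (m i)) (Fin (n i)) F))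
    (k : Fin ℓ) (r : ℕ) (hr : 0 < r) (hrm : r + m k ≤ Module.finrank F 𝒞)
    (h : ∑ i ∈ Finset.Iio k, n i < genWt 𝒞 (r + m k)) :
    genWt 𝒞 r + 1 ≤ genWt 𝒞 (r + m k) := by
  classical
  -- an optimal subcode
  have hne : {w | ∃ 𝒟 : Submodule F (∀ i : Fin ℓ, Matrix (Fin (m i)) (Fin (n i)) F),
    𝒟 ≤ 𝒞 ∧ r + m k ≤ Module.finrank F 𝒟 ∧ w = wtCode 𝒟}.Nonempty := ⟨_, 𝒞, le_rfl, hrm, rfl⟩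
  obtain ⟨𝒟, h𝒟, h𝒟r, h𝒟w⟩ := Nat.sInf_mem hne
  have hne2 : {w | ∃ A : ∀ i : Fin ℓ, Submodule F (Matrix (Fin (m i)) (Fin (n i)) F),
    (∀ i, IsOptRkAnticode (A i)) ∧ 𝒟 ≤ Submodule.pi Set.univ A ∧
    w = maxsrk (Submodule.pi Set.univ A)}.Nonempty :=
    ⟨_, fun _ => ⊤, fun i => top_opt (hnm i), fun _ _ _ _ => trivial, rfl⟩
  obtain ⟨A, hA, h𝒟A, hAw⟩ := Nat.sInf_mem hne2
  have hw : genWt 𝒞 (r + m k) = ∑ i, maxRk (A i) := by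
    rw [← maxsrk_pi, ← hAw]
    exact h𝒟w
  -- find a block `i ≥ k` with positive maximal rank
  obtain ⟨i, hik, hpos⟩ : ∃ i, k ≤ i ∧ 0 < maxRk (A i) := by
    by_contra hcon
    push Not at hcon
    rw [hw] at h
    have h1 : ∑ i, maxRk (A i) = ∑ i ∈ Finset.Iio k, maxRk (A i) := by
      symm
      apply Finset.sum_subset (Finset.subset_univ _)
      intro i _ hi
      have := hcon i (by simpa using hi)
      omega
    have h2 : ∑ i ∈ Finset.Iio k, maxRk (A i) ≤ ∑ i ∈ Finset.Iio k, n i :=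
      Finset.sum_le_sum fun i _ => maxRk_le (A i)
    omega
  obtain ⟨B, hBA, hBo, hBr, hBd⟩ := anticode_drop (hnm i) (A i) (hA i) hpos
  let A' : ∀ i : Fin ℓ, Submodule F (Matrix (Fin (m i)) (Fin (n i)) F) := Function.update A i B
  have hA' : ∀ j, IsOptRkAnticode (A' j) := by
    intro j
    by_cases hj : j = i
    · subst hj
      simp only [A', Function.update_self]
      exact hBo
    · simp only [A', Function.update_of_ne hj]
      exact hA j
  have hsum : ∑ j, maxRk (A' j) + 1 ≤ ∑ j, maxRk (A j) := by
    rw [← Finset.add_sum_erase _ _ (Finset.mem_univ i),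
      ← Finset.add_sum_erase _ (fun j => maxRk (A j)) (Finset.mem_univ i)]
    have h1 : ∑ j ∈ Finset.univ.erase i, maxRk (A' j) = ∑ j ∈ Finset.univ.erase i, maxRk (A j) := by
      apply Finset.sum_congr rfl
      intro j hj
      simp only [A', Function.update_of_ne (Finset.ne_of_mem_erase hj)]
    rw [h1]
    simp only [A', Function.update_self]
    omega
  -- the smaller subcode
  let f : 𝒟 →ₗ[F] (A i) := LinearMap.codRestrict (A i)
    ((LinearMap.proj i).comp 𝒟.subtype) (fun x => h𝒟A x.2 i (Set.mem_univ i))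
  let B₁ : Submodule F (A i) := B.comap (A i).subtype
  let g := B₁.mkQ.comp f
  let 𝒟' := (LinearMap.ker g).map 𝒟.subtype
  have h𝒟'𝒟 : 𝒟' ≤ 𝒟 := Submodule.map_subtype_le _ _
  have hfr : r ≤ Module.finrank F 𝒟' := by
    have e1 : Module.finrank F 𝒟' = Module.finrank F (LinearMap.ker g) :=
      Submodule.finrank_map_subtype_eq _ _
    have e2 := LinearMap.finrank_range_add_finrank_ker g
    have e3 := Submodule.finrank_le (LinearMap.range g)
    have e4 := Submodule.finrank_quotient_add_finrank B₁
    have e5 : Module.finrank F B₁ = Module.finrank F B :=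
      (Submodule.comapSubtypeEquivOfLe hBA).finrank_eq
    have e6 := hm k i hik
    omega
  have h𝒟'A' : 𝒟' ≤ Submodule.pi Set.univ A' := by
    rintro _ ⟨x, hx, rfl⟩ j _
    by_cases hj : j = i
    · subst hj
      simp only [A', Function.update_self]
      have hx1 : B₁.mkQ (f x) = 0 := hx
      rw [Submodule.mkQ_apply, Submodule.Quotient.mk_eq_zero] at hx1
      exact hx1
    · simp only [A', Function.update_of_ne hj]
      exact h𝒟A x.2 j (Set.mem_univ j)
  have hwt : wtCode 𝒟' ≤ ∑ j, maxRk (A' j) :=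
    Nat.sInf_le ⟨A', hA', h𝒟'A', (maxsrk_pi A').symm⟩
  have hgen : genWt 𝒞 r ≤ wtCode 𝒟' := Nat.sInf_le ⟨𝒟', h𝒟'𝒟.trans h𝒟, hfr, rfl⟩
  omega
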